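/- arXiv:1006.1958 — 2 statements merged into one kernel-verified Lean document; each statement's English description precedes it below -/
import Mathlib

section
/- Let T be an effect-clan on a nonempty set X satisfying (RDP). If the characteristic function χ_A belongs to T (A ⊆ X) and g ∈ T, then the pointwise product g·χ_A belongs to T and g·χ_A is the infimum of g and χ_A in the pointwise partial order on T. In particular, if χ_A, χ_B ∈ T then χ_{A ∩ B} ∈ T. -/
open MeasureTheory Topology Filter

/-- The characteristic function of a set `A`, valued in `ℝ`. -/
noncomputable def chi {X : Type*} (A : Set X) : X → ℝ := A.indicator 1

/-- An effect-clan on `X`: a set of `[0,1]`-valued functions containing `1`, closed under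
complement `f ↦ 1 - f`, and closed under sums `f + g` whenever `f + g ≤ 1` pointwise. -/
def IsEffectClan {X : Type*} (T : Set (X → ℝ)) : Prop :=
  (∀ f ∈ T, ∀ x, f x ∈ Set.Icc (0 : ℝ) 1) ∧
  (1 : X → ℝ) ∈ T ∧
  (∀ f ∈ T, (1 : X → ℝ) - f ∈ T) ∧
  (∀ f ∈ T, ∀ g ∈ T, (∀ x, f x + g x ≤ 1) → f + g ∈ T)

/-- An effect-tribe: an effect-clan closed under pointwise limits of pointwise
nondecreasing sequences. -/
def IsEffectTribe {X : Type*} (T : Set (X → ℝ)) : Prop :=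
  IsEffectClan T ∧
  ∀ (f : ℕ → X → ℝ) (g : X → ℝ), (∀ n, f n ∈ T) → (∀ n, f n ≤ f (n + 1)) →
    (∀ x, Filter.Tendsto (fun n => f n x) Filter.atTop (nhds (g x))) → g ∈ T

/-- The Riesz decomposition property for a set of functions. -/
def ClanRDP {X : Type*} (T : Set (X → ℝ)) : Prop :=
  ∀ f₁ ∈ T, ∀ f₂ ∈ T, ∀ g₁ ∈ T, ∀ g₂ ∈ T, f₁ + f₂ = g₁ + g₂ →
    ∃ c₁₁ ∈ T, ∃ c₁₂ ∈ T, ∃ c₂₁ ∈ T, ∃ c₂₂ ∈ T,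
      f₁ = c₁₁ + c₁₂ ∧ f₂ = c₂₁ + c₂₂ ∧ g₁ = c₁₁ + c₂₁ ∧ g₂ = c₁₂ + c₂₂

theorem IsEffectClan.mul_chi_mem {X : Type*} {T : Set (X → ℝ)} (hT : IsEffectClan T)
    (hRDP : ClanRDP T) {A : Set X} (hA : chi A ∈ T) {g : X → ℝ} (hg : g ∈ T) :
    g * chi A ∈ T := by
  obtain ⟨hIcc, -, hcompl, -⟩ := hT
  obtain ⟨c₁₁, h₁₁, c₁₂, h₁₂, c₂₁, h₂₁, c₂₂, h₂₂, hf₁, hf₂, hg₁, -⟩ :=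
    hRDP (chi A) hA (1 - chi A) (hcompl _ hA) g hg (1 - g) (hcompl _ hg) (by simp)
  convert h₁₁ using 1
  funext x
  have e₁ := congrFun hf₁ x
  have e₂ := congrFun hf₂ x
  have e₃ := congrFun hg₁ x
  have p₁₁ := (hIcc _ h₁₁ x).1
  have p₁₂ := (hIcc _ h₁₂ x).1
  have p₂₁ := (hIcc _ h₂₁ x).1
  have p₂₂ := (hIcc _ h₂₂ x).1
  by_cases hx : x ∈ A <;> simp [chi, hx] at e₁ e₂ e₃ ⊢ <;> linarith

/-- Let `T` be an effect-clan on `X ≠ ∅` satisfying (RDP).  If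
`χ_A ∈ T` and `g ∈ T`, then the pointwise product `g · χ_A` belongs to `T` and is the
infimum of `g` and `χ_A` in the pointwise order on `T`.  In particular `χ_A, χ_B ∈ T`
implies `χ_{A ∩ B} ∈ T`. -/
theorem stmt_12 {X : Type*} [Nonempty X] (T : Set (X → ℝ)) (hT : IsEffectClan T)
    (hRDP : ClanRDP T) :
    (∀ (A : Set X), chi A ∈ T → ∀ g ∈ T, g * chi A ∈ T ∧
      g * chi A ≤ g ∧ g * chi A ≤ chi A ∧
      ∀ r ∈ T, r ≤ g → r ≤ chi A → r ≤ g * chi A) ∧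
    ∀ A B : Set X, chi A ∈ T → chi B ∈ T → chi (A ∩ B) ∈ T := by
  refine ⟨fun A hA g hg => ⟨hT.mul_chi_mem hRDP hA hg, fun x => ?_, fun x => ?_,
    fun r _ hrg hrA x => ?_⟩, fun A B hA hB => ?_⟩
  · have h := hT.1 g hg x
    by_cases hx : x ∈ A <;> simp [chi, hx, h.1]
  · have h := hT.1 g hg x
    by_cases hx : x ∈ A <;> simp [chi, hx, h.2]
  · have h₁ := hrg x
    have h₂ := hrA x
    by_cases hx : x ∈ A <;> simp_all [chi]
  · have h : chi (A ∩ B) = chi A * chi B := Set.inter_indicator_one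
    exact h ▸ hT.mul_chi_mem hRDP hB hA
end

section
/- Let T be an effect-tribe on a nonempty set X satisfying (RDP). Then the collection S₀(T) = {A ⊆ X : χ_A ∈ T} is a σ-algebra of subsets of X: it contains X, is closed under complements, and is closed under countable unions. -/
open MeasureTheory Topology Filter

theorem chi_compl {X : Type*} (A : Set X) : chi Aᶜ = 1 - chi A :=
  Set.indicator_compl A 1

theorem IsEffectClan.chi_compl_mem {X : Type*} {T : Set (X → ℝ)} (hT : IsEffectClan T)
    {A : Set X} (hA : chi A ∈ T) : chi Aᶜ ∈ T := by
  rw [chi_compl]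
  exact hT.2.2.1 _ hA

theorem IsEffectClan.chi_inter_mem {X : Type*} {T : Set (X → ℝ)} (hT : IsEffectClan T)
    (hRDP : ClanRDP T) {A B : Set X} (hA : chi A ∈ T) (hB : chi B ∈ T) :
    chi (A ∩ B) ∈ T := by
  obtain ⟨c₁₁, h₁₁, c₁₂, h₁₂, c₂₁, h₂₁, c₂₂, h₂₂, hfA, -, hgB, hgB'⟩ :=
    hRDP _ hA _ (hT.chi_compl_mem hA) _ hB _ (hT.chi_compl_mem hB)
      (by rw [chi_compl, chi_compl]; abel)
  convert h₁₁ using 1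
  funext x
  have e₁ := congrFun hfA x
  have e₂ := congrFun hgB x
  have e₃ := congrFun hgB' x
  have n₁₁ := (hT.1 _ h₁₁ x).1
  have n₁₂ := (hT.1 _ h₁₂ x).1
  have n₂₁ := (hT.1 _ h₂₁ x).1
  have n₂₂ := (hT.1 _ h₂₂ x).1
  by_cases hxA : x ∈ A <;> by_cases hxB : x ∈ B <;>
    simp [chi, hxA, hxB] at e₁ e₂ e₃ ⊢ <;> linarith

theorem IsEffectClan.chi_union_mem {X : Type*} {T : Set (X → ℝ)} (hT : IsEffectClan T)
    (hRDP : ClanRDP T) {A B : Set X} (hA : chi A ∈ T) (hB : chi B ∈ T) :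
    chi (A ∪ B) ∈ T := by
  rw [← compl_compl (A ∪ B), Set.compl_union]
  exact hT.chi_compl_mem (hT.chi_inter_mem hRDP (hT.chi_compl_mem hA) (hT.chi_compl_mem hB))

theorem IsEffectTribe.chi_iUnion_mem_of_monotone {X : Type*} {T : Set (X → ℝ)}
    (hT : IsEffectTribe T) {A : ℕ → Set X} (hmono : Monotone A) (hA : ∀ n, chi (A n) ∈ T) :
    chi (⋃ n, A n) ∈ T :=
  hT.2 (fun n => chi (A n)) _ hA
    (fun n => Set.indicator_le_indicator_of_subset (hmono n.le_succ) fun _ => zero_le_one)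
    fun x => (hmono.tendsto_indicator A 1 x).mono_right (pure_le_nhds _)

/-- Let `T` be an effect-tribe on `X ≠ ∅` satisfying (RDP).  Then
`S₀(T) = {A ⊆ X : χ_A ∈ T}` is a σ-algebra of subsets of `X`: it contains `X`, and is
closed under complements and countable unions. -/
theorem stmt_13 {X : Type*} [Nonempty X] (T : Set (X → ℝ)) (hT : IsEffectTribe T)
    (hRDP : ClanRDP T) :
    chi (Set.univ : Set X) ∈ T ∧
    (∀ A : Set X, chi A ∈ T → chi Aᶜ ∈ T) ∧
    ∀ A : ℕ → Set X, (∀ n, chi (A n) ∈ T) → chi (⋃ n, A n) ∈ T := by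
  refine ⟨?_, fun A hA => hT.1.chi_compl_mem hA, fun A hA => ?_⟩
  · rw [chi, Set.indicator_univ]
    exact hT.1.2.1
  · have hps : ∀ n, chi (partialSups A n) ∈ T := by
      intro n
      induction n with
      | zero => simpa using hA 0
      | succ n ih =>
        rw [partialSups_add_one]
        exact hT.1.chi_union_mem hRDP ih (hA (n + 1))
    have hU : ⋃ n, A n = ⋃ n, partialSups A n := (iSup_partialSups_eq A).symm
    rw [hU]
    exact hT.chi_iUnion_mem_of_monotone (partialSups A).monotone hps
end
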